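/- Let B be a Boolean algebra and F ⊆ B an independent set, meaning: for all finite X, Y ⊆ F, if ⨅X ≤ ⨆Y then X ∩ Y ≠ ∅ (with ⨅∅ = ⊤ and ⨆∅ = ⊥). Let f : F → [0,1] be any function. Then there exists a finitely additive probability measure μ on B such that for all finite disjoint X, Y ⊆ F: μ( ⨅X ⊓ (⨆Y)ᶜ ) = ∏_{x∈X} f(x) · ∏_{y∈Y} (1 − f(y)). -/

import Mathlib

/-- A finitely additive probability measure on a Boolean algebra: `[0,1]`-valued,
`μ ⊤ = 1`, `μ ⊥ = 0`, and additive on disjoint joins. -/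
def IsFinAddProb {B : Type*} [BooleanAlgebra B] (μ : B → ℝ) : Prop :=
  (∀ a, 0 ≤ μ a ∧ μ a ≤ 1) ∧ μ ⊤ = 1 ∧ μ ⊥ = 0 ∧
    ∀ a b : B, a ⊓ b = ⊥ → μ (a ⊔ b) = μ a + μ b

/-- An independent subset of a Boolean algebra: for all finite `X, Y ⊆ F`,
if `⨅X ≤ ⨆Y` then `X ∩ Y ≠ ∅` (with `⨅∅ = ⊤` and `⨆∅ = ⊥`). -/
def IndepFamily {B : Type*} [BooleanAlgebra B] (F : Set B) : Prop :=
  ∀ X Y : Finset B, ↑X ⊆ F → ↑Y ⊆ F → X.inf id ≤ Y.sup id → ∃ x, x ∈ X ∧ x ∈ Y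

/-- Every nonzero element of a Boolean algebra has mass one for some finitely
additive probability measure. -/
theorem exists_isFinAddProb_eq_one {B : Type*} [BooleanAlgebra B] {e : B} (he : e ≠ ⊥) :
    ∃ φ : B → ℝ, IsFinAddProb φ ∧ φ e = 1 := by
  classical
  have hdisj : Disjoint (Order.PFilter.principal e : Set B)
      (Order.Ideal.principal (⊥ : B) : Set B) := by
    rw [Set.disjoint_left]
    intro a ha hb
    have h₁ : e ≤ a := ha
    have h₂ : a ≤ ⊥ := hb
    exact he (le_bot_iff.mp (h₁.trans h₂))
  obtain ⟨J, hJ, -, hdJ⟩ := DistribLattice.prime_ideal_of_disjoint_filter_ideal hdisj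
  have heJ : e ∉ J := fun h => Set.disjoint_left.mp hdJ (show e ≤ e from le_rfl) h
  have htop : (⊤ : B) ∉ J := fun h => heJ (J.lower le_top h)
  refine ⟨fun a => if a ∈ J then 0 else 1, ⟨fun a => ?_, by simp [htop], by simp, ?_⟩,
    by simp [heJ]⟩
  · dsimp only
    split_ifs <;> norm_num
  · intro a b hab
    have hor : a ∈ J ∨ b ∈ J := hJ.mem_or_mem (hab ▸ J.bot_mem)
    simp only [Order.Ideal.sup_mem_iff]
    by_cases ha : a ∈ J <;> by_cases hb : b ∈ J <;> simp_all

theorem IsFinAddProb.mono {B : Type*} [BooleanAlgebra B] {μ : B → ℝ} (hμ : IsFinAddProb μ)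
    {a b : B} (h : a ≤ b) : μ a ≤ μ b := by
  have := hμ.2.2.2 a (b \ a) inf_sdiff_self_right
  rw [sup_sdiff_cancel_right h] at this
  linarith [(hμ.1 (b \ a)).1]

theorem IsFinAddProb.eq_zero_of_disjoint {B : Type*} [BooleanAlgebra B] {μ : B → ℝ}
    (hμ : IsFinAddProb μ) {a e : B} (he : μ e = 1) (h : a ⊓ e = ⊥) : μ a = 0 := by
  linarith [hμ.2.2.2 a e h, (hμ.1 (a ⊔ e)).2, (hμ.1 a).1]

/-- A convex combination of finitely additive probability measures is one. -/
theorem IsFinAddProb.sum {B ι : Type*} [BooleanAlgebra B] {s : Finset ι} {w : ι → ℝ}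
    {φ : ι → B → ℝ} (hw : ∀ i ∈ s, 0 ≤ w i) (hw₁ : ∑ i ∈ s, w i = 1)
    (hφ : ∀ i ∈ s, IsFinAddProb (φ i)) : IsFinAddProb fun a => ∑ i ∈ s, w i * φ i a := by
  refine ⟨fun a => ⟨?_, ?_⟩, ?_, ?_, fun a b hab => ?_⟩
  · exact Finset.sum_nonneg fun i hi => mul_nonneg (hw i hi) ((hφ i hi).1 a).1
  · rw [← hw₁]
    exact Finset.sum_le_sum fun i hi => mul_le_of_le_one_right (hw i hi) ((hφ i hi).1 a).2
  · rw [← hw₁]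
    exact Finset.sum_congr rfl fun i hi => by rw [(hφ i hi).2.1, mul_one]
  · exact Finset.sum_eq_zero fun i hi => by rw [(hφ i hi).2.2.1, mul_zero]
  · rw [← Finset.sum_add_distrib]
    exact Finset.sum_congr rfl fun i hi => by rw [(hφ i hi).2.2.2 a b hab, mul_add]

/-- Finitely many members of an independent family can be given the product measure. -/
theorem IndepFamily.exists_isFinAddProb_finset {B : Type*} [BooleanAlgebra B] {F : Set B}
    (hF : IndepFamily F) {f : B → ℝ} (hf : ∀ x ∈ F, 0 ≤ f x ∧ f x ≤ 1)
    {G : Finset B} (hG : ↑G ⊆ F) :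
    ∃ μ : B → ℝ, IsFinAddProb μ ∧ ∀ X Y : Finset B, X ⊆ G → Y ⊆ G → Disjoint X Y →
      μ (X.inf id ⊓ (Y.sup id)ᶜ) = (∏ x ∈ X, f x) * ∏ y ∈ Y, (1 - f y) := by
  classical
  have hne : ∀ S ∈ G.powerset, S.inf id ⊓ ((G \ S).sup id)ᶜ ≠ ⊥ := by
    intro S hS h
    have hSG := Finset.mem_powerset.mp hS
    obtain ⟨x, hx, hx'⟩ := hF S (G \ S) (fun x hx => hG (hSG hx))
      (fun x hx => hG (Finset.sdiff_subset hx))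
      (disjoint_compl_right_iff.mp (disjoint_iff.mpr h))
    exact (Finset.mem_sdiff.mp hx').2 hx
  choose! φ hφ hφ₁ using fun S hS => exists_isFinAddProb_eq_one (hne S hS)
  refine ⟨fun a => ∑ S ∈ G.powerset, ((∏ x ∈ S, f x) * ∏ y ∈ G \ S, (1 - f y)) * φ S a,
    IsFinAddProb.sum (fun S hS => ?_) ?_ hφ, fun X Y hX hY hXY => ?_⟩
  · have hSG := Finset.mem_powerset.mp hS
    exact mul_nonneg (Finset.prod_nonneg fun x hx => (hf x (hG (hSG hx))).1)
      (Finset.prod_nonneg fun y hy =>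
        sub_nonneg.mpr (hf y (hG (Finset.sdiff_subset hy))).2)
  · rw [← Finset.prod_add]
    simp
  · have hprod : (∏ x ∈ X, f x) * ∏ y ∈ Y, (1 - f y) =
        ∏ i ∈ G, ((if i ∈ Y then 0 else f i) + if i ∈ X then 0 else 1 - f i) := by
      rw [← Finset.prod_subset (Finset.union_subset hX hY), Finset.prod_union hXY]
      · congr 1
        · exact Finset.prod_congr rfl fun i hi => by
            simp [hi, Finset.disjoint_left.mp hXY hi]
        · exact Finset.prod_congr rfl fun i hi => by
            simp [hi, Finset.disjoint_right.mp hXY hi]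
      · intro i _ hi
        simp only [Finset.mem_union, not_or] at hi
        simp [hi.1, hi.2]
    rw [hprod, Finset.prod_add]
    refine Finset.sum_congr rfl fun S hS => ?_
    have hSG := Finset.mem_powerset.mp hS
    by_cases hXS : X ⊆ S
    · by_cases hYS : Disjoint Y S
      · have hφX : φ S (X.inf id ⊓ (Y.sup id)ᶜ) = 1 := by
          refine le_antisymm ((hφ S hS).1 _).2 ?_
          rw [← hφ₁ S hS]
          exact (hφ S hS).mono (inf_le_inf (Finset.inf_mono hXS) (compl_le_compl
            (Finset.sup_mono (Finset.subset_sdiff.mpr ⟨hY, hYS⟩))))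
        rw [hφX, mul_one]
        congr 1
        · exact Finset.prod_congr rfl fun i hi => by simp [Finset.disjoint_right.mp hYS hi]
        · exact Finset.prod_congr rfl fun i hi => by
            rw [if_neg fun h => (Finset.mem_sdiff.mp hi).2 (hXS h)]
      · obtain ⟨y, hyY, hyS⟩ := Finset.not_disjoint_iff.mp hYS
        rw [(hφ S hS).eq_zero_of_disjoint (hφ₁ S hS), mul_zero,
          Finset.prod_eq_zero hyS (by simp [hyY]), zero_mul]
        exact disjoint_iff.mp ((disjoint_compl_left (a := y)).mono
          (inf_le_right.trans (compl_le_compl (Finset.le_sup (f := id) hyY)))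
          (inf_le_left.trans (Finset.inf_le (f := id) hyS)))
    · obtain ⟨x, hxX, hxS⟩ := Finset.not_subset.mp hXS
      have hx : x ∈ G \ S := Finset.mem_sdiff.mpr ⟨hX hxX, hxS⟩
      rw [(hφ S hS).eq_zero_of_disjoint (hφ₁ S hS), mul_zero,
        Finset.prod_eq_zero hx (by simp [hxX]), mul_zero]
      exact disjoint_iff.mp ((disjoint_compl_right (a := x)).mono
        (inf_le_left.trans (Finset.inf_le (f := id) hxX))
        (inf_le_right.trans (compl_le_compl (Finset.le_sup (f := id) hx))))

/-- The finitely additive probability measures form a compact set in the topology of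
pointwise convergence. -/
theorem isCompact_setOf_isFinAddProb {B : Type*} [BooleanAlgebra B] :
    IsCompact {μ : B → ℝ | IsFinAddProb μ} := by
  refine (isCompact_univ_pi fun _ : B => isCompact_Icc (a := (0 : ℝ)) (b := 1)).of_isClosed_subset
    ?_ fun μ hμ a _ => hμ.1 a
  simp only [IsFinAddProb, Set.ofPred_and, Set.ofPred_forall]
  refine .inter (isClosed_iInter fun a => .inter ?_ ?_) (.inter ?_ (.inter ?_
    (isClosed_iInter fun a => isClosed_iInter fun b => isClosed_iInter fun _ => ?_)))
  · exact isClosed_le (by fun_prop) (by fun_prop)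
  · exact isClosed_le (by fun_prop) (by fun_prop)
  all_goals exact isClosed_eq (by fun_prop) (by fun_prop)

theorem stmt12 {B : Type*} [BooleanAlgebra B] (F : Set B) (hF : IndepFamily F)
    (f : B → ℝ) (hf : ∀ x ∈ F, 0 ≤ f x ∧ f x ≤ 1) :
    ∃ μ : B → ℝ, IsFinAddProb μ ∧
      ∀ X Y : Finset B, ↑X ⊆ F → ↑Y ⊆ F → Disjoint X Y →
        μ (X.inf id ⊓ (Y.sup id)ᶜ) =
          (∏ x ∈ X, f x) * ∏ y ∈ Y, (1 - f y) := by
  classical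
  have hG : ∀ G : Finset F, (↑(G.map (Function.Embedding.subtype _)) : Set B) ⊆ F := by
    intro G x hx
    obtain ⟨y, -, rfl⟩ := Finset.mem_map.mp (Finset.mem_coe.mp hx)
    exact y.2
  choose ν hν hνprod using fun G : Finset F => hF.exists_isFinAddProb_finset hf (hG G)
  let U : Ultrafilter (Finset F) := Ultrafilter.of Filter.atTop
  obtain ⟨μ, hμ, hle⟩ := isCompact_setOf_isFinAddProb.ultrafilter_le_nhds (U.map ν)
    (Filter.tendsto_principal.mpr (Filter.Eventually.of_forall hν))
  have hlim : Filter.Tendsto ν U (nhds μ) := hle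
  refine ⟨μ, hμ, fun X Y hX hY hXY => ?_⟩
  refine tendsto_nhds_unique_of_eventuallyEq (tendsto_pi_nhds.mp hlim _) tendsto_const_nhds ?_
  refine Ultrafilter.of_le Filter.atTop ?_
  filter_upwards [Filter.eventually_ge_atTop ((X ∪ Y).subtype (· ∈ F))] with G hle
  have hmem : ∀ x ∈ X ∪ Y, x ∈ F → x ∈ G.map (Function.Embedding.subtype _) := fun x hx hxF =>
    Finset.mem_map.mpr ⟨⟨x, hxF⟩, hle (Finset.mem_subtype.mpr hx), rfl⟩
  exact hνprod G X Y (fun x hx => hmem x (Finset.mem_union_left _ hx) (hX hx))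
    (fun y hy => hmem y (Finset.mem_union_right _ hy) (hY hy)) hXY
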